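/- arXiv:2303.11582 — 2 statements merged into one kernel-verified Lean document; each statement's English description precedes it below -/
import Mathlib

section
/- The function g is differentiable on (0,∞)^K and, for each arm a, ∂g/∂v_a (v) = E[Z_a · 1{μ_a + v_a Z_a > W_a}] = E[φ((W_a − μ_a)/v_a)], where W_a = max_{a'≠a} (μ_{a'} + v_{a'} Z_{a'}). -/
open MeasureTheory ProbabilityTheory

/-- Product of `K` independent standard Gaussians on `Fin K → ℝ`. -/
noncomputable def gaussPi (K : ℕ) : Measure (Fin K → ℝ) :=
  Measure.pi fun _ => gaussianReal 0 1

/-- Standard normal density `φ`. -/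
noncomputable def stdNormalPDF (x : ℝ) : ℝ :=
  (Real.sqrt (2 * Real.pi))⁻¹ * Real.exp (-(x ^ 2) / 2)

/-- `g(v) = E[max_a (μ_a + v_a Z_a)]` for i.i.d. standard normals `Z_a`. -/
noncomputable def gfun (K : ℕ) (μ : Fin K → ℝ) (v : Fin K → ℝ) : ℝ :=
  ∫ z, (⨆ a, (μ a + v a * z a)) ∂(gaussPi K)

/-- A finite supremum of continuous real functions is continuous. -/
lemma continuous_ciSup_of_finite {X ι : Type*} [TopologicalSpace X] [Finite ι]
    {f : ι → X → ℝ} (hf : ∀ i, Continuous (f i)) : Continuous fun x => ⨆ i, f i x := by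
  cases nonempty_fintype ι
  rcases isEmpty_or_nonempty ι with h | h
  · simpa [Real.iSup_of_isEmpty] using (continuous_const : Continuous fun _ : X => (0 : ℝ))
  · simp_rw [← Finset.sup'_univ_eq_ciSup]
    exact Continuous.finset_sup'_apply _ fun i _ => hf i

/-- A finite supremum is Lipschitz for the uniform distance between families. -/
lemma abs_ciSup_sub_ciSup_le {ι : Type*} [Finite ι] [Nonempty ι] {f g : ι → ℝ} {C : ℝ}
    (h : ∀ i, |f i - g i| ≤ C) : |(⨆ i, f i) - ⨆ i, g i| ≤ C := by
  have hf : BddAbove (Set.range f) := Set.finite_range f |>.bddAbove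
  have hg : BddAbove (Set.range g) := Set.finite_range g |>.bddAbove
  rw [abs_sub_le_iff]
  constructor
  · rw [sub_le_iff_le_add]
    refine ciSup_le fun i => ?_
    have := le_ciSup hg i
    have := (abs_sub_le_iff.1 (h i)).1
    linarith
  · rw [sub_le_iff_le_add]
    refine ciSup_le fun i => ?_
    have := le_ciSup hf i
    have := (abs_sub_le_iff.1 (h i)).2
    linarith

lemma ciSup_lt_of_finite {ι : Type*} [Finite ι] [Nonempty ι] {f : ι → ℝ} {c : ℝ}
    (h : ∀ i, f i < c) : (⨆ i, f i) < c := by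
  obtain ⟨i, hi⟩ := exists_eq_ciSup_of_finite (f := f)
  exact hi ▸ h i

instance isProbabilityMeasure_gaussPi (K : ℕ) : IsProbabilityMeasure (gaussPi K) := by
  unfold gaussPi
  infer_instance

lemma stdNormalPDF_eq_gaussianPDFReal (x : ℝ) : stdNormalPDF x = gaussianPDFReal 0 1 x := by
  simp [stdNormalPDF, gaussianPDFReal]

lemma hasDerivAt_stdNormalPDF (x : ℝ) :
    HasDerivAt stdNormalPDF (-(x * stdNormalPDF x)) x := by
  have h : HasDerivAt (fun y : ℝ => -(y ^ 2) / 2) (-x) x := by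
    refine ((hasDerivAt_pow 2 x).fun_neg.div_const 2).congr_deriv ?_
    norm_num
    ring
  refine (h.exp.const_mul (Real.sqrt (2 * Real.pi))⁻¹).congr_deriv ?_
  simp only [stdNormalPDF]
  ring

lemma continuous_stdNormalPDF : Continuous stdNormalPDF := by
  unfold stdNormalPDF
  fun_prop

lemma integrable_id_gaussianReal : Integrable (fun x : ℝ => x) (gaussianReal 0 1) :=
  (memLp_id_gaussianReal (μ := 0) (v := 1) 1).integrable (by simp)

lemma integrable_mul_stdNormalPDF : Integrable fun x : ℝ => x * stdNormalPDF x := by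
  have h := integrable_id_gaussianReal
  rw [gaussianReal_of_var_ne_zero _ one_ne_zero, gaussianPDF_def,
    integrable_withDensity_iff_integrable_smul₀'
      (measurable_gaussianPDFReal 0 1).ennreal_ofReal.aemeasurable (by simp)] at h
  refine h.congr (.of_forall fun x => ?_)
  simp [ENNReal.toReal_ofReal (gaussianPDFReal_nonneg 0 1 x), stdNormalPDF_eq_gaussianPDFReal,
    mul_comm]

lemma tendsto_stdNormalPDF_atTop : Filter.Tendsto stdNormalPDF Filter.atTop (nhds 0) := by
  have h : Filter.Tendsto (fun x : ℝ => -(x ^ 2) / 2) Filter.atTop Filter.atBot := by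
    have := (Filter.tendsto_pow_atTop (α := ℝ) two_ne_zero).atTop_div_const (two_pos)
    simp_rw [neg_div]
    exact Filter.tendsto_neg_atTop_atBot.comp this
  have h' := (Real.tendsto_exp_atBot.comp h).const_mul (Real.sqrt (2 * Real.pi))⁻¹
  rwa [mul_zero] at h'

/-- The truncated first moment of a standard normal variable. -/
lemma integral_ite_lt_gaussianReal (c : ℝ) :
    ∫ x, (if c < x then x else 0) ∂(gaussianReal 0 1) = stdNormalPDF c := by
  rw [integral_gaussianReal_eq_integral_smul one_ne_zero]
  have h1 : (fun x : ℝ => gaussianPDFReal 0 1 x • (if c < x then x else 0))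
      = (Set.Ioi c).indicator fun x => x * stdNormalPDF x := by
    ext x
    by_cases h : c < x <;> simp [Set.indicator, h, stdNormalPDF_eq_gaussianPDFReal, mul_comm]
  rw [h1, integral_indicator measurableSet_Ioi]
  have := integral_Ioi_of_hasDerivAt_of_tendsto' (a := c) (f := fun x => -stdNormalPDF x)
    (f' := fun x => x * stdNormalPDF x) (m := 0)
    (fun x _ => (hasDerivAt_stdNormalPDF x).fun_neg.congr_deriv (neg_neg _))
    integrable_mul_stdNormalPDF.integrableOn (by simpa using tendsto_stdNormalPDF_atTop.neg)
  simpa using this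

/-- Splitting off one coordinate of a standard Gaussian vector. -/
lemma measurePreserving_insertNth_gaussPi {n : ℕ} (a : Fin (n + 1)) :
    MeasurePreserving (fun p : (Fin n → ℝ) × ℝ => (a.insertNth p.2 p.1 : Fin (n + 1) → ℝ))
      ((gaussPi n).prod (gaussianReal 0 1)) (gaussPi (n + 1)) :=
  ((measurePreserving_piFinSuccAbove (fun _ : Fin (n + 1) => gaussianReal 0 1) a).symm).comp
    Measure.measurePreserving_swap

lemma integrable_eval_gaussPi {K : ℕ} (a : Fin K) : Integrable (fun z => z a) (gaussPi K) :=
  (measurePreserving_eval (fun _ : Fin K => gaussianReal 0 1) a).integrable_comp_of_integrable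
    integrable_id_gaussianReal

lemma integrable_norm_gaussPi (K : ℕ) : Integrable (fun z => ‖z‖) (gaussPi K) := by
  refine (integrable_finsetSum Finset.univ
    fun a _ => (integrable_eval_gaussPi (K := K) a).norm).mono'
    continuous_norm.aestronglyMeasurable (.of_forall fun z => ?_)
  rw [norm_norm, pi_norm_le_iff_of_nonneg (Finset.sum_nonneg fun _ _ => norm_nonneg _)]
  exact fun a => Finset.single_le_sum (f := fun a => ‖z a‖) (fun _ _ => norm_nonneg _)
    (Finset.mem_univ a)

/-- Almost surely, a coordinate differs from any measurable function of the other ones. -/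
lemma ae_eval_ne_gaussPi {K : ℕ} (a : Fin K) {c : (Fin K → ℝ) → ℝ} (hc : Measurable c)
    (hca : ∀ z t, c (Function.update z a t) = c z) : ∀ᵐ z ∂(gaussPi K), z a ≠ c z := by
  obtain _ | n := K
  · exact a.elim0
  have hmp := measurePreserving_insertNth_gaussPi a
  have hs : MeasurableSet {z : Fin (n + 1) → ℝ | z a ≠ c z} :=
    (measurableSet_eq_fun (measurable_pi_apply a) hc).compl
  rw [← hmp.map_eq, ae_map_iff hmp.measurable.aemeasurable hs,
    Measure.ae_prod_iff_ae_ae (p := fun p : (Fin n → ℝ) × ℝ =>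
      (a.insertNth p.2 p.1 : Fin (n + 1) → ℝ) a ≠ c (a.insertNth p.2 p.1)) (hmp.measurable hs)]
  refine .of_forall fun y => ?_
  have hd : ∀ x, c (a.insertNth x y) = c (a.insertNth 0 y) := fun x => by
    rw [← hca (a.insertNth x y) 0, Fin.update_insertNth]
  have := nullSingletonClass_gaussianReal (μ := 0) (v := 1) one_ne_zero
  simpa [hd] using Measure.ae_ne (gaussianReal 0 1) (c (a.insertNth 0 y))

/-- The truncated first moment of a coordinate, with a threshold that depends measurably on the
other coordinates. -/
lemma integral_ite_lt_gaussPi {K : ℕ} (a : Fin K) {c : (Fin K → ℝ) → ℝ} (hc : Measurable c)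
    (hca : ∀ z t, c (Function.update z a t) = c z) :
    ∫ z, (if c z < z a then z a else 0) ∂(gaussPi K) = ∫ z, stdNormalPDF (c z) ∂(gaussPi K) := by
  obtain _ | n := K
  · exact a.elim0
  have hmp := measurePreserving_insertNth_gaussPi a
  have hd : ∀ x y, c (a.insertNth x y) = c (a.insertNth 0 y) := fun x y => by
    rw [← hca (a.insertNth x y) 0, Fin.update_insertNth]
  have hm : Measurable fun z : Fin (n + 1) → ℝ => if c z < z a then z a else 0 :=
    Measurable.ite (measurableSet_lt hc (measurable_pi_apply a)) (measurable_pi_apply a)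
      measurable_const
  have hi : Integrable (fun z : Fin (n + 1) → ℝ => if c z < z a then z a else 0)
      (gaussPi (n + 1)) :=
    (integrable_eval_gaussPi a).mono hm.aestronglyMeasurable
      (.of_forall fun z => by split_ifs <;> simp)
  have hi' := hmp.integrable_comp_of_integrable hi
  have hm' : Measurable fun z => stdNormalPDF (c z) := continuous_stdNormalPDF.measurable.comp hc
  rw [← hmp.map_eq, integral_map hmp.measurable.aemeasurable hm.aestronglyMeasurable,
    integral_map hmp.measurable.aemeasurable hm'.aestronglyMeasurable]
  refine (integral_prod _ hi').trans ?_
  simp only [Function.comp_apply, hd, Fin.insertNth_apply_same, integral_ite_lt_gaussianReal]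
  rw [integral_fun_fst (μ := gaussPi n) (ν := gaussianReal 0 1)
    (fun y => stdNormalPDF (c (a.insertNth 0 y)))]
  simp

/-- The gradient in `v` of `max_a (μ_a + v_a z_a)`, away from ties. -/
noncomputable def maxGradient {K : ℕ} (μ v z : Fin K → ℝ) : (Fin K → ℝ) →L[ℝ] ℝ :=
  ∑ a, (if (⨆ a' : {b : Fin K // b ≠ a}, (μ a'.1 + v a'.1 * z a'.1)) < μ a + v a * z a
    then z a else 0) • ContinuousLinearMap.proj (R := ℝ) (φ := fun _ : Fin K => ℝ) a

lemma hasFDerivAt_ciSup {K : ℕ} (hK : 2 ≤ K) {μ v z : Fin K → ℝ}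
    (hz : ∀ a b, a ≠ b → μ a + v a * z a ≠ μ b + v b * z b) :
    HasFDerivAt (fun w : Fin K → ℝ => ⨆ a, (μ a + w a * z a)) (maxGradient μ v z) v := by
  have : Nontrivial (Fin K) := Fin.nontrivial_iff_two_le.2 hK
  obtain ⟨b, hb⟩ := Finite.exists_max fun a => μ a + v a * z a
  have hlt : ∀ a, a ≠ b → μ a + v a * z a < μ b + v b * z b :=
    fun a ha => lt_of_le_of_ne (hb a) (hz a b ha)
  have hgrad : maxGradient μ v z
      = z b • ContinuousLinearMap.proj (R := ℝ) (φ := fun _ : Fin K => ℝ) b := by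
    unfold maxGradient
    rw [Finset.sum_eq_single b]
    · obtain ⟨d, hd⟩ := exists_ne b
      have : Nonempty {c : Fin K // c ≠ b} := ⟨⟨d, hd⟩⟩
      rw [if_pos (ciSup_lt_of_finite fun a' : {c : Fin K // c ≠ b} => hlt a'.1 a'.2)]
    · intro a _ ha
      have := le_ciSup (Set.finite_range
        fun a' : {c : Fin K // c ≠ a} => μ a'.1 + v a'.1 * z a'.1).bddAbove ⟨b, ha.symm⟩
      rw [if_neg (not_lt.2 ((hb a).trans this)), zero_smul]
    · simp
  have hev : ∀ᶠ w in nhds v, ∀ a, μ a + w a * z a ≤ μ b + w b * z b := by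
    rw [Filter.eventually_all]
    intro a
    by_cases hab : a = b
    · simp [hab]
    · exact (ContinuousAt.eventually_lt (f := fun w : Fin K → ℝ => μ a + w a * z a)
        (g := fun w : Fin K → ℝ => μ b + w b * z b)
        (Continuous.continuousAt (by fun_prop)) (Continuous.continuousAt (by fun_prop))
        (hlt a hab)).mono fun w hw => hw.le
  have hlin : HasFDerivAt (fun w : Fin K → ℝ => μ b + w b * z b) (maxGradient μ v z) v := by
    rw [hgrad]
    exact ((hasFDerivAt_apply b v).mul_const (z b)).const_add (μ b)
  refine hlin.congr_of_eventuallyEq (hev.mono fun w hw => ?_)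
  exact le_antisymm (ciSup_le hw)
    (le_ciSup (Set.finite_range fun a => μ a + w a * z a).bddAbove b)

lemma measurable_ite_argmax {K : ℕ} (μ v : Fin K → ℝ) (a : Fin K) :
    Measurable fun z : Fin K → ℝ =>
      if (⨆ a' : {b : Fin K // b ≠ a}, (μ a'.1 + v a'.1 * z a'.1)) < μ a + v a * z a
        then z a else 0 :=
  Measurable.ite (measurableSet_lt
    (continuous_ciSup_of_finite fun _ => by fun_prop).measurable (by fun_prop))
    (measurable_pi_apply a) measurable_const

lemma integrable_ite_argmax {K : ℕ} (μ v : Fin K → ℝ) (a : Fin K) :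
    Integrable (fun z : Fin K → ℝ =>
      if (⨆ a' : {b : Fin K // b ≠ a}, (μ a'.1 + v a'.1 * z a'.1)) < μ a + v a * z a
        then z a else 0) (gaussPi K) :=
  (integrable_eval_gaussPi a).mono (measurable_ite_argmax μ v a).aestronglyMeasurable
    (.of_forall fun z => by split_ifs <;> simp)

lemma integrable_maxGradient {K : ℕ} (μ v : Fin K → ℝ) :
    Integrable (fun z => maxGradient μ v z) (gaussPi K) := by
  unfold maxGradient
  exact integrable_finsetSum Finset.univ fun a _ => (integrable_ite_argmax μ v a).smul_const
    (ContinuousLinearMap.proj (R := ℝ) (φ := fun _ : Fin K => ℝ) a)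

lemma ae_no_ties_gaussPi {K : ℕ} (μ : Fin K → ℝ) {v : Fin K → ℝ} (hv : ∀ a, 0 < v a) :
    ∀ᵐ z ∂(gaussPi K), ∀ a b, a ≠ b → μ a + v a * z a ≠ μ b + v b * z b := by
  simp_rw [ae_all_iff]
  intro a b hab
  filter_upwards [ae_eval_ne_gaussPi a (c := fun z => (μ b + v b * z b - μ a) / v a)
    (by fun_prop) (fun z t => by simp [Function.update_of_ne hab.symm])] with z hz h
  refine hz ?_
  rw [← h]
  field_simp [(hv a).ne']
  ring

lemma hasFDerivAt_gfun {K : ℕ} (hK : 2 ≤ K) (μ : Fin K → ℝ) {v : Fin K → ℝ}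
    (hv : ∀ a, 0 < v a) :
    HasFDerivAt (gfun K μ) (∫ z, maxGradient μ v z ∂(gaussPi K)) v := by
  have : Nonempty (Fin K) := ⟨⟨0, by omega⟩⟩
  have hcont : ∀ w : Fin K → ℝ, Continuous fun z : Fin K → ℝ => ⨆ a, (μ a + w a * z a) :=
    fun w => continuous_ciSup_of_finite fun _ => by fun_prop
  have hlip : ∀ (z w w' : Fin K → ℝ),
      |(⨆ a, (μ a + w a * z a)) - ⨆ a, (μ a + w' a * z a)| ≤ ‖z‖ * ‖w - w'‖ := by
    intro z w w'
    refine abs_ciSup_sub_ciSup_le fun a => ?_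
    have h : μ a + w a * z a - (μ a + w' a * z a) = z a * (w - w') a := by
      simp only [Pi.sub_apply]; ring
    rw [h, abs_mul]
    exact mul_le_mul (norm_le_pi_norm z a) (norm_le_pi_norm (w - w') a) (abs_nonneg _)
      (norm_nonneg _)
  refine (hasFDerivAt_integral_of_dominated_loc_of_lip (μ := gaussPi K) (s := Set.univ)
    (bound := fun z => ‖z‖) (F := fun w z => ⨆ a, (μ a + w a * z a))
    (F' := maxGradient μ v) Filter.univ_mem
    (.of_forall fun w => (hcont w).aestronglyMeasurable) ?_
    (integrable_maxGradient μ v).aestronglyMeasurable (.of_forall fun z => ?_)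
    (integrable_norm_gaussPi K)
    ((ae_no_ties_gaussPi μ hv).mono fun z hz => hasFDerivAt_ciSup hK hz)).2
  · refine (((integrable_norm_gaussPi K).mul_const ‖v‖).add
      (integrable_const |⨆ a, μ a|)).mono' (hcont v).aestronglyMeasurable
      (.of_forall fun z => ?_)
    have h := hlip z v 0
    simp only [Pi.zero_apply, zero_mul, add_zero, sub_zero] at h
    have h' := abs_add_le ((⨆ a, (μ a + v a * z a)) - ⨆ a, μ a) (⨆ a, μ a)
    rw [sub_add_cancel] at h'
    simp only [Real.norm_eq_abs, Pi.add_apply]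
    exact h'.trans (by linarith)
  · refine LipschitzOnWith.of_dist_le_mul fun w _ w' _ => ?_
    rw [Real.dist_eq, dist_eq_norm, Real.coe_nnabs, abs_norm]
    exact hlip z w w'

/-- `g` is differentiable on `(0,∞)^K` and, for each arm `a`,
`∂g/∂v_a (v) = E[Z_a 1{μ_a + v_a Z_a > W_a}] = E[φ((W_a − μ_a)/v_a)]`, where
`W_a = max_{a'≠a} (μ_{a'} + v_{a'} Z_{a'})`. -/
theorem stmt3 (K : ℕ) (hK : 2 ≤ K) (μ : Fin K → ℝ) :
    DifferentiableOn ℝ (gfun K μ) {v | ∀ a, 0 < v a} ∧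
    ∀ v : Fin K → ℝ, (∀ a, 0 < v a) → ∀ a : Fin K,
      HasDerivAt (fun t => gfun K μ (Function.update v a t))
        (∫ z, (if (⨆ a' : {b : Fin K // b ≠ a}, (μ a'.1 + v a'.1 * z a'.1))
              < μ a + v a * z a then z a else 0) ∂(gaussPi K))
        (v a) ∧
      (∫ z, (if (⨆ a' : {b : Fin K // b ≠ a}, (μ a'.1 + v a'.1 * z a'.1))
              < μ a + v a * z a then z a else 0) ∂(gaussPi K))
        = ∫ z, stdNormalPDF
            (((⨆ a' : {b : Fin K // b ≠ a}, (μ a'.1 + v a'.1 * z a'.1)) - μ a) / v a)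
          ∂(gaussPi K) := by
  refine ⟨fun v hv => (hasFDerivAt_gfun hK μ hv).differentiableAt.differentiableWithinAt,
    fun v hv a => ⟨?_, ?_⟩⟩
  · have h := hasFDerivAt_gfun hK μ hv
    refine (h.comp_hasDerivAt_of_eq (v a) (hasDerivAt_update v a (v a))
      (Function.update_eq_self a v).symm).congr_deriv ?_
    rw [ContinuousLinearMap.integral_apply (integrable_maxGradient μ v)]
    refine integral_congr_ae (.of_forall fun z => ?_)
    simp [maxGradient, -ite_smul, -smul_ite, Pi.single_apply]
  · have hc : Continuous fun z : Fin K → ℝ =>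
        ((⨆ a' : {b : Fin K // b ≠ a}, (μ a'.1 + v a'.1 * z a'.1)) - μ a) / v a :=
      ((continuous_ciSup_of_finite fun _ => by fun_prop).sub continuous_const).div_const _
    rw [← integral_ite_lt_gaussPi a hc.measurable fun z t => ?_]
    · refine integral_congr_ae (.of_forall fun z => ?_)
      simp only [div_lt_iff₀ (hv a), sub_lt_iff_lt_add', mul_comm (z a)]
    · congr 3
      ext a'
      rw [Function.update_of_ne a'.2]
end

section
/- Assume the arms are sorted so that μ_1 > μ_2 > … > μ_K. Then for each of the top two arms a ∈ {1, 2}, E[(1/σ_a) · φ((θ_a* − μ_a)/σ_a)] ≥ (1/2)^{K−2} · [1 / (2 sqrt(2π(σ_1² + σ_2²)))] · exp(−(μ_1 − μ_2)² / (2(σ_1² + σ_2²))). -/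
open MeasureTheory ProbabilityTheory

open scoped NNReal in
/-- The product of two Gaussian densities is a constant multiple of a Gaussian density. -/
lemma gaussianPDFReal_mul_gaussianPDFReal (m n x : ℝ) {v w : ℝ≥0} (hv : v ≠ 0) (hw : w ≠ 0) :
    gaussianPDFReal m v x * gaussianPDFReal n w x =
      gaussianPDFReal m (v + w) n *
        gaussianPDFReal ((w * m + v * n) / (v + w)) (v * w / (v + w)) x := by
  have hv' : (0 : ℝ) < v := NNReal.coe_pos.2 (pos_iff_ne_zero.2 hv)
  have hw' : (0 : ℝ) < w := NNReal.coe_pos.2 (pos_iff_ne_zero.2 hw)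
  have hpi := Real.pi_pos
  have hsqrt : √(2 * Real.pi * v) * √(2 * Real.pi * w) =
      √(2 * Real.pi * (v + w)) * √(2 * Real.pi * (v * w / (v + w))) := by
    rw [← Real.sqrt_mul (by positivity), ← Real.sqrt_mul (by positivity)]
    congr 1
    field_simp
  simp only [gaussianPDFReal]
  push_cast
  rw [mul_mul_mul_comm, mul_mul_mul_comm (√(2 * Real.pi * (v + w)))⁻¹, ← mul_inv, ← mul_inv,
    hsqrt, ← Real.exp_add, ← Real.exp_add]
  congr 2
  field_simp
  ring

open scoped NNReal in
/-- A nondegenerate Gaussian is at most its mean with probability one half. -/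
lemma measureReal_gaussianReal_Iic_mean (m : ℝ) {v : ℝ≥0} (hv : v ≠ 0) :
    (gaussianReal m v).real (Set.Iic m) = 1 / 2 := by
  have := nullSingletonClass_gaussianReal (μ := m) hv
  have hsymm : (gaussianReal m v).real (Set.Iic m) = (gaussianReal m v).real (Set.Ici m) := by
    have hmap : (gaussianReal m v).map (fun x ↦ 2 * m - x) = gaussianReal m v := by
      rw [gaussianReal_map_const_sub]
      ring_nf
    conv_lhs => rw [← hmap, map_measureReal_apply (by fun_prop) measurableSet_Iic]
    congr 1
    ext x
    simp only [Set.mem_preimage, Set.mem_Iic, Set.mem_Ici]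
    constructor <;> intro h <;> linarith
  have hcompl := probReal_compl_eq_one_sub (μ := gaussianReal m v) (measurableSet_Iic (a := m))
  rw [Set.compl_Iic, ← measureReal_congr Ioi_ae_eq_Ici.symm] at hcompl
  linarith

open scoped NNReal in
/-- A nondegenerate Gaussian is at least its mean with probability one half. -/
lemma measureReal_gaussianReal_Ici_mean (m : ℝ) {v : ℝ≥0} (hv : v ≠ 0) :
    (gaussianReal m v).real (Set.Ici m) = 1 / 2 := by
  have := nullSingletonClass_gaussianReal (μ := m) hv
  have hcompl := probReal_compl_eq_one_sub (μ := gaussianReal m v) (measurableSet_Iic (a := m))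
  rw [Set.compl_Iic, measureReal_congr Ioi_ae_eq_Ici, measureReal_gaussianReal_Iic_mean m hv]
    at hcompl
  linarith

open scoped NNReal in
lemma gaussianPDFReal_le (m x : ℝ) (v : ℝ≥0) :
    gaussianPDFReal m v x ≤ (√(2 * Real.pi * v))⁻¹ := by
  refine mul_le_of_le_one_right (by positivity) (Real.exp_le_one_iff.2 ?_)
  rw [neg_div]
  exact neg_nonpos.2 (by positivity)

open scoped NNReal in
/-- Half of the mass of the product of two Gaussian densities lies above its center. -/
lemma integral_indicator_Ici_gaussianPDFReal (m n : ℝ) {v w : ℝ≥0} (hv : v ≠ 0) (hw : w ≠ 0) :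
    ∫ x, (Set.Ici ((w * m + v * n) / (v + w))).indicator (gaussianPDFReal m v) x
        ∂(gaussianReal n w) =
      gaussianPDFReal m (v + w) n / 2 := by
  set c : ℝ := (w * m + v * n) / (v + w)
  have hτ : v * w / (v + w) ≠ 0 := by positivity
  have key (x : ℝ) : gaussianPDFReal n w x • (Set.Ici c).indicator (gaussianPDFReal m v) x =
      gaussianPDFReal m (v + w) n *
        (gaussianPDFReal c (v * w / (v + w)) x • (Set.Ici c).indicator 1 x) := by
    by_cases hx : x ∈ Set.Ici c
    · simp only [Set.indicator_of_mem hx, smul_eq_mul, Pi.one_apply, mul_one]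
      rw [mul_comm, gaussianPDFReal_mul_gaussianPDFReal m n x hv hw]
    · simp [Set.indicator_of_notMem hx]
  rw [integral_gaussianReal_eq_integral_smul hw, integral_congr_ae (ae_of_all _ key),
    integral_const_mul, ← integral_gaussianReal_eq_integral_smul hτ,
    integral_indicator_one measurableSet_Ici, measureReal_gaussianReal_Ici_mean c hτ]
  ring

open scoped NNReal in
/-- For independent Gaussians `θ i`, the expected density of `θ a` at the maximum of the other
variables is bounded below by that of a competitor `b`, up to a factor `1 / 2` for each variable
other than `a`, provided all remaining means lie below those of `a` and `b`. -/
lemma le_integral_gaussianPDFReal_iSup {ι : Type*} [Fintype ι] [DecidableEq ι]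
    (μ : ι → ℝ) (v : ι → ℝ≥0) (hv : ∀ i, v i ≠ 0) {a b : ι} (hab : b ≠ a)
    (ha : ∀ i, i ≠ a → i ≠ b → μ i ≤ μ a) (hb : ∀ i, i ≠ a → i ≠ b → μ i ≤ μ b) :
    (1 / 2 : ℝ) ^ (Fintype.card ι - 2) * (gaussianPDFReal (μ a) (v a + v b) (μ b) / 2) ≤
      ∫ θ : ι → ℝ, gaussianPDFReal (μ a) (v a) (⨆ i : {i : ι // i ≠ a}, θ i.1)
        ∂(Measure.pi fun i ↦ gaussianReal (μ i) (v i)) := by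
  set c : ℝ := (v b * μ a + v a * μ b) / (v a + v b) with hc
  have hva : (0 : ℝ) < v a := NNReal.coe_pos.2 (pos_iff_ne_zero.2 (hv a))
  have hvb : (0 : ℝ) < v b := NNReal.coe_pos.2 (pos_iff_ne_zero.2 (hv b))
  have hle (i : ι) (hia : i ≠ a) (hib : i ≠ b) : μ i ≤ c := by
    rw [hc, le_div_iff₀ (by positivity)]
    nlinarith [mul_le_mul_of_nonneg_left (ha i hia hib) hvb.le,
      mul_le_mul_of_nonneg_left (hb i hia hib) hva.le]
  let f (i : ι) : ℝ → ℝ :=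
    if i = a then 1 else if i = b then (Set.Ici c).indicator (gaussianPDFReal (μ a) (v a))
    else (Set.Iic (μ i)).indicator 1
  have hfa : f a = 1 := if_pos rfl
  have hfb : f b = (Set.Ici c).indicator (gaussianPDFReal (μ a) (v a)) := by simp [f, hab]
  have hfi (i : ι) (hia : i ≠ a) (hib : i ≠ b) : f i = (Set.Iic (μ i)).indicator 1 := by
    simp [f, hia, hib]
  have hf0 (i : ι) (x : ℝ) : 0 ≤ f i x := by
    by_cases hia : i = a
    · simp [hia, hfa]
    by_cases hib : i = b
    · rw [hib, hfb]
      exact Set.indicator_nonneg (fun y _ ↦ gaussianPDFReal_nonneg _ _ y) x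
    · rw [hfi i hia hib]
      exact Set.indicator_nonneg (fun _ _ ↦ zero_le_one) x
  have hmem : b ∈ Finset.univ.erase a := Finset.mem_erase.2 ⟨hab, Finset.mem_univ b⟩
  have hsplit (g : ι → ℝ) : ∏ i, g i = g a * (g b * ∏ i ∈ (Finset.univ.erase a).erase b, g i) := by
    rw [Finset.mul_prod_erase _ _ hmem, Finset.mul_prod_erase _ _ (Finset.mem_univ a)]
  have hprod : ∫ θ : ι → ℝ, ∏ i, f i (θ i) ∂(Measure.pi fun i ↦ gaussianReal (μ i) (v i)) =
      (1 / 2 : ℝ) ^ (Fintype.card ι - 2) * (gaussianPDFReal (μ a) (v a + v b) (μ b) / 2) := by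
    have hrest : ∀ i ∈ (Finset.univ.erase a).erase b,
        ∫ x, f i x ∂(gaussianReal (μ i) (v i)) = 1 / 2 := fun i hi ↦ by
      simp only [Finset.mem_erase] at hi
      rw [hfi i hi.2.1 hi.1, integral_indicator_one measurableSet_Iic,
        measureReal_gaussianReal_Iic_mean _ (hv i)]
    rw [integral_fintype_prod_eq_prod, hsplit, Finset.prod_congr rfl hrest, hfa, hfb,
      integral_indicator_Ici_gaussianPDFReal _ _ (hv a) (hv b), Finset.prod_const,
      Finset.card_erase_of_mem hmem, Finset.card_erase_of_mem (Finset.mem_univ a),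
      Finset.card_univ, Nat.sub_sub]
    simp [mul_comm]
  rw [← hprod]
  refine integral_mono_of_nonneg (ae_of_all _ fun θ ↦ Finset.prod_nonneg fun i _ ↦ hf0 i _)
    ?_ (ae_of_all _ fun θ ↦ ?_)
  · refine Integrable.of_bound (C := (√(2 * Real.pi * v a))⁻¹) ?_ (ae_of_all _ fun θ ↦ ?_)
    · exact ((measurable_gaussianPDFReal _ _).comp
        (Measurable.iSup fun i ↦ measurable_pi_apply i.1)).aestronglyMeasurable
    · rw [Real.norm_of_nonneg (gaussianPDFReal_nonneg _ _ _)]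
      exact gaussianPDFReal_le _ _ _
  · by_cases hθ : c ≤ θ b ∧ ∀ i, i ≠ a → i ≠ b → θ i ≤ μ i
    · have : Nonempty {i : ι // i ≠ a} := ⟨⟨b, hab⟩⟩
      have hsup : ⨆ i : {i : ι // i ≠ a}, θ i.1 = θ b := by
        refine le_antisymm (ciSup_le fun i ↦ ?_)
          (le_ciSup (f := fun i : {i : ι // i ≠ a} ↦ θ i.1) (Set.finite_range _).bddAbove ⟨b, hab⟩)
        by_cases hib : i.1 = b
        · rw [hib]
        · exact (hθ.2 i i.2 hib).trans ((hle i i.2 hib).trans hθ.1)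
      have hrest : ∀ i ∈ (Finset.univ.erase a).erase b, f i (θ i) = 1 := fun i hi ↦ by
        simp only [Finset.mem_erase] at hi
        rw [hfi i hi.2.1 hi.1, Set.indicator_of_mem (Set.mem_Iic.2 (hθ.2 i hi.2.1 hi.1)), Pi.one_apply]
      beta_reduce
      rw [hsplit, Finset.prod_eq_one hrest, hfa, hfb, Set.indicator_of_mem (Set.mem_Ici.2 hθ.1), hsup]
      simp
    · have hzero : ∃ i, f i (θ i) = 0 := by
        by_cases hcb : c ≤ θ b
        · push Not at hθ
          obtain ⟨i, hia, hib, hi⟩ := hθ hcb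
          exact ⟨i, by rw [hfi i hia hib, Set.indicator_of_notMem (by simpa using hi)]⟩
        · exact ⟨b, by rw [hfb, Set.indicator_of_notMem (by simpa using hcb)]⟩
      obtain ⟨i, hi⟩ := hzero
      beta_reduce
      rw [Finset.prod_eq_zero (Finset.mem_univ i) hi]
      exact gaussianPDFReal_nonneg _ _ _

lemma one_div_mul_stdNormalPDF (m x : ℝ) {s : ℝ} (hs : 0 < s) :
    (1 / s) * stdNormalPDF ((x - m) / s) = gaussianPDFReal m (Real.toNNReal (s ^ 2)) x := by
  rw [stdNormalPDF, gaussianPDFReal, Real.coe_toNNReal _ (by positivity),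
    Real.sqrt_mul (x := 2 * Real.pi) (by positivity), Real.sqrt_sq hs.le, mul_inv, ← mul_assoc,
    mul_comm (1 / s), one_div]
  congr 2
  field_simp

/-- Suppose the arms are sorted so that `μ_1 > μ_2 > … > μ_K`
(arm `1` is the index `⟨0, _⟩ : Fin K` and arm `2` is `⟨1, _⟩`). Then for each of the
top two arms `a ∈ {1, 2}`,
`E[(1/σ_a) φ((θ_a* − μ_a)/σ_a)]
  ≥ (1/2)^{K−2} · (2 sqrt(2π(σ_1²+σ_2²)))⁻¹ · e^{−(μ_1−μ_2)²/(2(σ_1²+σ_2²))}`. -/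
theorem stmt14 (K : ℕ) (hK : 2 ≤ K)
    (μ σ : Fin K → ℝ) (hσ : ∀ a, 0 < σ a)
    (hsort : ∀ i j : Fin K, i < j → μ j < μ i) :
    ∀ a : Fin K, (a = ⟨0, by omega⟩ ∨ a = ⟨1, by omega⟩) →
      (1 / 2 : ℝ) ^ (K - 2)
          * (2 * Real.sqrt (2 * Real.pi
              * ((σ ⟨0, by omega⟩) ^ 2 + (σ ⟨1, by omega⟩) ^ 2)))⁻¹
          * Real.exp (-(μ ⟨0, by omega⟩ - μ ⟨1, by omega⟩) ^ 2
              / (2 * ((σ ⟨0, by omega⟩) ^ 2 + (σ ⟨1, by omega⟩) ^ 2)))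
        ≤ ∫ θ : Fin K → ℝ,
            (1 / σ a) * stdNormalPDF
              (((⨆ a' : {b : Fin K // b ≠ a}, θ a'.1) - μ a) / σ a)
          ∂(Measure.pi fun a' => gaussianReal (μ a') (Real.toNNReal ((σ a') ^ 2))) := by
  intro a ha
  have hpos (i : Fin K) : Real.toNNReal (σ i ^ 2) ≠ 0 :=
    (Real.toNNReal_pos.2 (pow_pos (hσ i) 2)).ne'
  have hmono {i j : Fin K} (hij : i ≤ j) : μ j ≤ μ i :=
    hij.eq_or_lt.elim (fun h ↦ h ▸ le_rfl) fun h ↦ (hsort i j h).le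
  simp_rw [one_div_mul_stdNormalPDF (μ a) _ (hσ a)]
  rcases ha with rfl | rfl
  · have h := le_integral_gaussianPDFReal_iSup μ _ hpos (a := ⟨0, by omega⟩) (b := ⟨1, by omega⟩)
      (by simp) (fun i _ _ ↦ hmono (by simp [Fin.le_def]))
      (fun i hi _ ↦ hmono (by simp only [ne_eq, Fin.ext_iff] at hi; simp only [Fin.le_def]; omega))
    refine le_of_eq_of_le ?_ h
    rw [Fintype.card_fin, gaussianPDFReal, NNReal.coe_add, Real.coe_toNNReal _ (sq_nonneg _),
      Real.coe_toNNReal _ (sq_nonneg _), sub_sq_comm, mul_inv]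
    ring
  · have h := le_integral_gaussianPDFReal_iSup μ _ hpos (a := ⟨1, by omega⟩) (b := ⟨0, by omega⟩)
      (by simp)
      (fun i _ hi ↦ hmono (by simp only [ne_eq, Fin.ext_iff] at hi; simp only [Fin.le_def]; omega))
      (fun i _ _ ↦ hmono (by simp [Fin.le_def]))
    refine le_of_eq_of_le ?_ h
    rw [Fintype.card_fin, gaussianPDFReal, NNReal.coe_add, Real.coe_toNNReal _ (sq_nonneg _),
      Real.coe_toNNReal _ (sq_nonneg _), mul_inv, add_comm (σ ⟨1, _⟩ ^ 2)]
    ring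
end
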